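/- Define φ(t) = (t + (ln(2π) - γ)/2)·e^{-t} + e^t·S(e^{-2t}) + 3t/(2·sinh t) for real t (with 3t/(2 sinh t) interpreted as 3/2 at t = 0), where S(a) = Σ_{n=1}^∞ [ln(n/a) - a/(2n) - ψ(n/a)]. Then φ is an even function: φ(t) = φ(-t) for all real t. -/

import Mathlib

open Real

/-- The digamma function `ψ(x) = Γ'(x)/Γ(x) = d(log Γ)/dx`. -/
noncomputable def digamma (x : ℝ) : ℝ := deriv (fun y : ℝ => Real.log (Real.Gamma y)) x

/-- `S(a) = Σ_{n=1}^∞ [ln(n/a) - a/(2n) - ψ(n/a)]`. -/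
noncomputable def S (a : ℝ) : ℝ :=
  ∑' n : ℕ+, (Real.log ((n : ℝ) / a) - a / (2 * (n : ℝ)) - digamma ((n : ℝ) / a))

/-- `φ(t) = (t + (ln(2π)-γ)/2) e^{-t} + e^t S(e^{-2t}) + 3t/(2 sinh t)`,
with the last term interpreted as `3/2` at `t = 0`. -/
noncomputable def phi (t : ℝ) : ℝ :=
  (t + (Real.log (2 * π) - Real.eulerMascheroniConstant) / 2) * Real.exp (-t)
    + Real.exp t * S (Real.exp (-2 * t))
    + (if t = 0 then 3 / 2 else 3 * t / (2 * Real.sinh t))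

open Filter Topology

lemma differentiableAt_log_Gamma {x : ℝ} (hx : 0 < x) :
    DifferentiableAt ℝ (fun y : ℝ => Real.log (Real.Gamma y)) x :=
  (Real.differentiableAt_Gamma fun m => ((neg_nonpos.mpr m.cast_nonneg).trans_lt hx).ne').log
    (Real.Gamma_pos_of_pos hx).ne'

lemma log_Gamma_add_one {x : ℝ} (hx : 0 < x) :
    Real.log (Real.Gamma (x + 1)) = Real.log x + Real.log (Real.Gamma x) := by
  rw [Real.Gamma_add_one hx.ne', Real.log_mul hx.ne' (Real.Gamma_pos_of_pos hx).ne']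

lemma digamma_add_one {x : ℝ} (hx : 0 < x) : digamma (x + 1) = digamma x + 1 / x := by
  have hshift : HasDerivAt (fun y : ℝ => Real.log (Real.Gamma (y + 1))) (digamma (x + 1)) x :=
    (differentiableAt_log_Gamma (by positivity : 0 < x + 1)).hasDerivAt.comp_add_const x 1
  have hsum : HasDerivAt (fun y : ℝ => Real.log y + Real.log (Real.Gamma y))
      (x⁻¹ + digamma x) x :=
    (Real.hasDerivAt_log hx.ne').add (differentiableAt_log_Gamma hx).hasDerivAt
  have heq : (fun y : ℝ => Real.log (Real.Gamma (y + 1))) =ᶠ[𝓝 x]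
      fun y : ℝ => Real.log y + Real.log (Real.Gamma y) := by
    filter_upwards [lt_mem_nhds hx] with y hy using log_Gamma_add_one hy
  rw [hshift.unique (hsum.congr_of_eventuallyEq heq)]
  ring

lemma slope_log_Gamma {x : ℝ} (hx : 0 < x) :
    slope (fun y : ℝ => Real.log (Real.Gamma y)) x (x + 1) = Real.log x := by
  rw [slope_def_field, log_Gamma_add_one hx]
  ring

lemma digamma_le_log {x : ℝ} (hx : 0 < x) : digamma x ≤ Real.log x :=
  slope_log_Gamma hx ▸ Real.convexOn_log_Gamma.deriv_le_slope (Set.mem_Ioi.2 hx)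
    (Set.mem_Ioi.2 (by positivity)) (by linarith) (differentiableAt_log_Gamma hx)

lemma log_le_digamma_add_one {x : ℝ} (hx : 0 < x) : Real.log x ≤ digamma (x + 1) :=
  slope_log_Gamma hx ▸ Real.convexOn_log_Gamma.slope_le_deriv (Set.mem_Ioi.2 hx)
    (Set.mem_Ioi.2 (by positivity)) (by linarith) (differentiableAt_log_Gamma (by positivity))

lemma log_add_one_sub_log_le {x : ℝ} (hx : 0 < x) :
    Real.log (x + 1) - Real.log x ≤ (2 * x + 1) / (2 * x * (x + 1)) := by
  rw [← Real.log_div (by positivity) hx.ne']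
  have hone : 1 ≤ (x + 1) / x := by rw [le_div_iff₀ hx]; linarith
  refine (Real.self_le_sinh_iff.2 (Real.log_nonneg hone)).trans_eq ?_
  rw [Real.sinh_log (by positivity)]
  field_simp
  ring

lemma le_log_add_one_sub_log {x : ℝ} (hx : 0 < x) :
    2 / (2 * x + 1) ≤ Real.log (x + 1) - Real.log x := by
  rw [← Real.log_div (by positivity) hx.ne']
  have h := Real.le_log_one_add_of_nonneg (x := 1 / x) (by positivity)
  convert h using 1
  · field_simp
    ring
  · congr 1
    field_simp

/-- The error in the two-term asymptotic expansion of the digamma function. -/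
noncomputable def digammaRemainder (x : ℝ) : ℝ := Real.log x - 1 / (2 * x) - digamma x

lemma abs_digammaRemainder_le {x : ℝ} (hx : 0 < x) : |digammaRemainder x| ≤ 1 / (2 * x) := by
  have h₁ := digamma_le_log hx
  have h₂ := log_le_digamma_add_one hx
  rw [digamma_add_one hx] at h₂
  have h₃ : 1 / x = 1 / (2 * x) + 1 / (2 * x) := by field_simp; norm_num
  rw [abs_le, digammaRemainder]
  constructor <;> linarith

lemma tendsto_digammaRemainder : Tendsto digammaRemainder atTop (𝓝 0) := by
  refine squeeze_zero_norm' (a := fun x => 1 / (2 * x)) ?_ ?_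
  · filter_upwards [eventually_gt_atTop 0] with x hx using abs_digammaRemainder_le hx
  · simp only [one_div]
    exact tendsto_inv_atTop_zero.comp (tendsto_id.const_mul_atTop (by norm_num : (0 : ℝ) < 2))

lemma digammaRemainder_sub_add_one {x : ℝ} (hx : 0 < x) :
    digammaRemainder x - digammaRemainder (x + 1) =
      (2 * x + 1) / (2 * x * (x + 1)) - (Real.log (x + 1) - Real.log x) := by
  rw [digammaRemainder, digammaRemainder, digamma_add_one hx]
  field_simp
  ring

lemma digammaRemainder_nonneg {x : ℝ} (hx : 0 < x) : 0 ≤ digammaRemainder x := by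
  have hanti : Antitone fun n : ℕ => digammaRemainder (x + n) := by
    refine antitone_nat_of_succ_le fun n => ?_
    have hn : 0 < x + n := by positivity
    have h₁ := digammaRemainder_sub_add_one hn
    have h₂ := log_add_one_sub_log_le hn
    push_cast
    rw [← add_assoc]
    linarith
  have hlim : Tendsto (fun n : ℕ => digammaRemainder (x + n)) atTop (𝓝 0) :=
    tendsto_digammaRemainder.comp (tendsto_atTop_add_const_left _ _ tendsto_natCast_atTop_atTop)
  simpa using hanti.le_of_tendsto hlim 0

lemma digammaRemainder_le {x : ℝ} (hx : 0 < x) : digammaRemainder x ≤ 1 / (8 * x ^ 2) := by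
  have hmono : Monotone fun n : ℕ => digammaRemainder (x + n) - 1 / (8 * (x + n) ^ 2) := by
    refine monotone_nat_of_le_succ fun n => ?_
    push_cast
    rw [← add_assoc]
    have hn : 0 < x + n := by positivity
    generalize x + (n : ℝ) = y at hn ⊢
    have h₁ := digammaRemainder_sub_add_one hn
    have h₂ := le_log_add_one_sub_log hn
    have h₃ : (2 * y + 1) / (2 * y * (y + 1)) - 2 / (2 * y + 1) ≤
        1 / (8 * y ^ 2) - 1 / (8 * (y + 1) ^ 2) := by
      rw [← sub_nonneg]
      have : 1 / (8 * y ^ 2) - 1 / (8 * (y + 1) ^ 2) -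
          ((2 * y + 1) / (2 * y * (y + 1)) - 2 / (2 * y + 1)) =
          1 / (8 * y ^ 2 * (y + 1) ^ 2 * (2 * y + 1)) := by
        field_simp
        ring
      rw [this]
      positivity
    linarith
  have hshift : Tendsto (fun n : ℕ => x + n) atTop atTop :=
    tendsto_atTop_add_const_left _ _ tendsto_natCast_atTop_atTop
  have hsq : Tendsto (fun y : ℝ => 1 / (8 * y ^ 2)) atTop (𝓝 0) := by
    simp only [one_div]
    exact tendsto_inv_atTop_zero.comp
      ((tendsto_pow_atTop two_ne_zero).const_mul_atTop (by norm_num : (0 : ℝ) < 8))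
  have hlim := (tendsto_digammaRemainder.sub hsq).comp hshift
  rw [sub_zero] at hlim
  have h := hmono.ge_of_tendsto hlim 0
  simp only [Nat.cast_zero, add_zero] at h
  linarith

lemma digammaRemainder_eq_add_sum {x : ℝ} (hx : 0 < x) (N : ℕ) :
    digammaRemainder x = Real.log x + 1 / (2 * x) - Real.log (x + N) - 1 / (2 * (x + N)) +
      digammaRemainder (x + N) + ∑ m ∈ Finset.range N, 1 / (x + (m + 1)) := by
  induction N with
  | zero => simp
  | succ N ih =>
    have hN : 0 < x + N := by positivity
    have h := digammaRemainder_sub_add_one hN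
    rw [Finset.sum_range_succ, ih]
    push_cast
    rw [← add_assoc x]
    have h₃ : (2 * (x + N) + 1) / (2 * (x + N) * (x + N + 1)) =
        1 / (2 * (x + N)) + 1 / (2 * (x + N + 1)) := by
      field_simp
      ring
    have h₄ : 1 / (x + N + 1) = 1 / (2 * (x + N + 1)) + 1 / (2 * (x + N + 1)) := by
      field_simp
      norm_num
    linarith

/-- An approximate primitive: its increment over `[x, x + 1]` is
`log (x + 1) + a / (2 * (x + 1)) + O(x⁻²)`. -/
noncomputable def logPrimitive (a x : ℝ) : ℝ :=
  x * Real.log x - x + (1 + a) / 2 * Real.log x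

/-- The error of `logPrimitive` over a unit interval. -/
noncomputable def logPrimitiveError (a x : ℝ) : ℝ :=
  logPrimitive a (x + 1) - logPrimitive a x - (Real.log (x + 1) + a / (2 * (x + 1)))

lemma logPrimitiveError_eq (a x : ℝ) :
    logPrimitiveError a x =
      (x + (1 + a) / 2) * (Real.log (x + 1) - Real.log x) - 1 - a / (2 * (x + 1)) := by
  rw [logPrimitiveError, logPrimitive, logPrimitive]
  ring

lemma logPrimitiveError_nonneg {a x : ℝ} (ha : 0 < a) (hx : 0 < x) :
    0 ≤ logPrimitiveError a x := by
  have h := mul_le_mul_of_nonneg_left (le_log_add_one_sub_log hx)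
    (by positivity : 0 ≤ x + (1 + a) / 2)
  have h' : (x + (1 + a) / 2) * (2 / (2 * x + 1)) - 1 - a / (2 * (x + 1)) =
      a / (2 * (2 * x + 1) * (x + 1)) := by
    field_simp
    ring
  have h'' : 0 ≤ a / (2 * (2 * x + 1) * (x + 1)) := by positivity
  rw [logPrimitiveError_eq]
  linarith

lemma logPrimitiveError_le {a x : ℝ} (ha : 0 < a) (hx : 0 < x) :
    logPrimitiveError a x ≤ (1 + a) / (4 * x ^ 2) := by
  have h := mul_le_mul_of_nonneg_left (log_add_one_sub_log_le hx)
    (by positivity : 0 ≤ x + (1 + a) / 2)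
  have h' : (x + (1 + a) / 2) * ((2 * x + 1) / (2 * x * (x + 1))) - 1 - a / (2 * (x + 1)) =
      (1 + a) / (4 * (x * (x + 1))) := by
    field_simp
    ring
  have h'' : (1 + a) / (4 * (x * (x + 1))) ≤ (1 + a) / (4 * x ^ 2) := by
    gcongr
    nlinarith
  rw [logPrimitiveError_eq]
  linarith

lemma sum_logPrimitive (a x : ℝ) (N : ℕ) :
    ∑ n ∈ Finset.range N, (Real.log (x + (n + 1)) + a / (2 * (x + (n + 1)))) =
      logPrimitive a (x + N) - logPrimitive a x -
        ∑ n ∈ Finset.range N, logPrimitiveError a (x + n) := by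
  have h := Finset.sum_range_sub (fun n : ℕ => logPrimitive a (x + n)) N
  simp only [Nat.cast_zero, add_zero] at h
  rw [← h, ← Finset.sum_sub_distrib]
  refine Finset.sum_congr rfl fun n _ => ?_
  rw [logPrimitiveError]
  push_cast
  rw [add_assoc]
  ring

/-- The double sum linking the partial sums for `a` and `a⁻¹`. -/
noncomputable def doubleSum (a : ℝ) (N : ℕ) : ℝ :=
  ∑ n ∈ Finset.range N, ∑ m ∈ Finset.range N, a / ((n + 1 : ℝ) + a * (m + 1))

lemma doubleSum_eq_mul_inv {a : ℝ} (ha : 0 < a) (N : ℕ) :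
    doubleSum a N = a * doubleSum a⁻¹ N := by
  rw [doubleSum, doubleSum, Finset.sum_comm, Finset.mul_sum]
  refine Finset.sum_congr rfl fun n _ => ?_
  rw [Finset.mul_sum]
  refine Finset.sum_congr rfl fun m _ => ?_
  field_simp
  ring

/-- The elementary part of the partial sums of `S`. -/
noncomputable def partialMain (a : ℝ) (N : ℕ) : ℝ :=
  Real.log N.factorial + a / 2 * harmonic N -
    (logPrimitive a (a * N + N) - logPrimitive a (a * N))

/-- The error part of the partial sums of `S`. -/
noncomputable def partialError (a : ℝ) (N : ℕ) : ℝ :=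
  ∑ n ∈ Finset.range N, (digammaRemainder ((n + 1) / a + N) + logPrimitiveError a (a * N + n))

lemma sum_digammaRemainder {a : ℝ} (ha : 0 < a) (N : ℕ) :
    ∑ n ∈ Finset.range N, digammaRemainder ((n + 1) / a) =
      partialMain a N + partialError a N + doubleSum a N := by
  have hterm : ∀ n : ℕ, digammaRemainder ((n + 1) / a) =
      Real.log (n + 1) + a / 2 * (n + 1 : ℝ)⁻¹ -
        (Real.log (a * N + (n + 1)) + a / (2 * (a * N + (n + 1)))) +
        digammaRemainder ((n + 1) / a + N) +
        ∑ m ∈ Finset.range N, a / ((n + 1 : ℝ) + a * (m + 1)) := by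
    intro n
    have hx : 0 < (n + 1 : ℝ) / a := by positivity
    rw [digammaRemainder_eq_add_sum hx N]
    have hadd : (n + 1 : ℝ) / a + N = (a * N + (n + 1)) / a := by
      field_simp
      ring
    have hlog₁ : Real.log ((n + 1 : ℝ) / a) = Real.log (n + 1) - Real.log a :=
      Real.log_div (by positivity) ha.ne'
    have hlog₂ : Real.log ((n + 1 : ℝ) / a + N) = Real.log (a * N + (n + 1)) - Real.log a := by
      rw [hadd, Real.log_div (by positivity) ha.ne']
    have hinv : 1 / (2 * ((n + 1 : ℝ) / a + N)) = a / (2 * (a * N + (n + 1))) := by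
      rw [hadd]
      field_simp
    have hinv' : 1 / (2 * ((n + 1 : ℝ) / a)) = a / 2 * (n + 1 : ℝ)⁻¹ := by
      field_simp
    have hsum : ∑ m ∈ Finset.range N, 1 / ((n + 1 : ℝ) / a + (m + 1)) =
        ∑ m ∈ Finset.range N, a / ((n + 1 : ℝ) + a * (m + 1)) := by
      refine Finset.sum_congr rfl fun m _ => ?_
      field_simp
    rw [hlog₁, hlog₂, hinv, hinv', hsum]
    ring
  have hfact : Real.log N.factorial = ∑ n ∈ Finset.range N, Real.log (n + 1) := by
    rw [← Finset.prod_range_add_one_eq_factorial, Nat.cast_prod, Real.log_prod]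
    · simp
    · intro n _
      positivity
  have hharm : (harmonic N : ℝ) = ∑ n ∈ Finset.range N, (n + 1 : ℝ)⁻¹ := by
    simp [harmonic]
  rw [Finset.sum_congr rfl fun n _ => hterm n]
  simp only [Finset.sum_add_distrib, Finset.sum_sub_distrib, ← Finset.mul_sum]
  rw [← Finset.sum_add_distrib (g := fun n : ℕ => a / (2 * (a * N + (n + 1 : ℝ)))),
    sum_logPrimitive, partialMain, partialError, doubleSum, hfact, hharm,
    Finset.sum_add_distrib]
  ring

lemma tendsto_partialError {a : ℝ} (ha : 0 < a) :
    Tendsto (partialError a) atTop (𝓝 0) := by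
  have hC : Tendsto (fun N : ℕ => (1 / 8 + (1 + a) / (4 * a ^ 2)) * (N : ℝ)⁻¹) atTop (𝓝 0) := by
    simpa using tendsto_natCast_atTop_atTop.inv_tendsto_atTop.const_mul
      (1 / 8 + (1 + a) / (4 * a ^ 2) : ℝ)
  refine squeeze_zero' ?_ ?_ hC
  · filter_upwards [eventually_gt_atTop 0] with N hN
    refine Finset.sum_nonneg fun n _ => add_nonneg (digammaRemainder_nonneg (by positivity))
      (logPrimitiveError_nonneg ha (by positivity))
  · filter_upwards [eventually_gt_atTop 0] with N hN
    have hN' : (0 : ℝ) < N := by exact_mod_cast hN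
    have hbound : ∀ n ∈ Finset.range N,
        digammaRemainder ((n + 1) / a + N) + logPrimitiveError a (a * N + n) ≤
          1 / (8 * (N : ℝ) ^ 2) + (1 + a) / (4 * (a * N) ^ 2) := by
      intro n _
      refine add_le_add ((digammaRemainder_le (by positivity)).trans ?_)
        ((logPrimitiveError_le ha (by positivity)).trans ?_)
      · gcongr
        exact le_add_of_nonneg_left (by positivity)
      · gcongr
        exact le_add_of_nonneg_right (by positivity)
    refine (Finset.sum_le_sum hbound).trans_eq ?_
    rw [Finset.sum_const, Finset.card_range, nsmul_eq_mul]
    field_simp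

lemma partialMain_sub {a : ℝ} (ha : 0 < a) {N : ℕ} (hN : 0 < N) :
    partialMain a N - a * partialMain a⁻¹ N =
      (1 - a) * (Real.log (Stirling.stirlingSeq N) + Real.log 2 / 2) -
        (1 - a) / 2 * (harmonic N - Real.log N) + (a + 1) / 2 * Real.log a := by
  have hN' : (0 : ℝ) < N := by exact_mod_cast hN
  have h₁ : Real.log (a * N + N) = Real.log (a + 1) + Real.log N := by
    rw [← Real.log_mul (by positivity) hN'.ne']
    ring_nf
  have h₂ : Real.log (a * N) = Real.log a + Real.log N := Real.log_mul ha.ne' hN'.ne'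
  have h₃ : Real.log (a⁻¹ * N + N) = Real.log (a + 1) - Real.log a + Real.log N := by
    rw [← Real.log_div (by positivity) ha.ne', ← Real.log_mul (by positivity) hN'.ne']
    congr 1
    field_simp
    ring
  have h₄ : Real.log (a⁻¹ * N) = -Real.log a + Real.log N := by
    rw [Real.log_mul (by positivity) hN'.ne', Real.log_inv]
  have h₅ : Real.log (2 * N) = Real.log 2 + Real.log N := Real.log_mul two_ne_zero hN'.ne'
  have h₆ : Real.log (N / Real.exp 1) = Real.log N - 1 := by
    rw [Real.log_div hN'.ne' (Real.exp_ne_zero 1), Real.log_exp]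
  rw [Stirling.log_stirlingSeq_formula]
  simp only [partialMain, logPrimitive, h₁, h₂, h₃, h₄, h₅, h₆]
  field_simp
  ring

lemma summable_digammaRemainder {a : ℝ} (ha : 0 < a) :
    Summable fun n : ℕ => digammaRemainder ((n + 1) / a) := by
  have hsq : Summable fun n : ℕ => a ^ 2 / 8 * (1 / ((n + 1 : ℕ) : ℝ) ^ 2) :=
    ((summable_nat_add_iff 1).2 (Real.summable_one_div_nat_pow.2 one_lt_two)).mul_left _
  refine hsq.of_nonneg_of_le (fun n => digammaRemainder_nonneg (by positivity)) fun n => ?_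
  refine (digammaRemainder_le (by positivity)).trans_eq ?_
  push_cast
  field_simp

lemma S_eq_tsum {a : ℝ} : S a = ∑' n : ℕ, digammaRemainder ((n + 1) / a) := by
  rw [S, tsum_pnat_eq_tsum_succ (f := fun n : ℕ =>
    Real.log ((n : ℝ) / a) - a / (2 * (n : ℝ)) - digamma ((n : ℝ) / a))]
  refine tsum_congr fun n => ?_
  rw [digammaRemainder, mul_div_assoc', one_div_div]
  push_cast
  rfl

lemma tendsto_sum_digammaRemainder {a : ℝ} (ha : 0 < a) :
    Tendsto (fun N : ℕ => ∑ n ∈ Finset.range N, digammaRemainder ((n + 1) / a)) atTop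
      (𝓝 (S a)) :=
  S_eq_tsum (a := a) ▸ (summable_digammaRemainder ha).hasSum.tendsto_sum_nat

/-- The functional equation of `S` under `a ↦ a⁻¹`. -/
theorem S_functional_equation {a : ℝ} (ha : 0 < a) :
    S a = a * S a⁻¹ + (Real.log (2 * π) - Real.eulerMascheroniConstant) / 2 * (1 - a) +
      (a + 1) / 2 * Real.log a := by
  have ha' : 0 < a⁻¹ := inv_pos.2 ha
  have hleft := (tendsto_sum_digammaRemainder ha).sub
    ((tendsto_sum_digammaRemainder ha').const_mul a)
  have hstirling := Stirling.tendsto_stirlingSeq_sqrt_pi.log (Real.sqrt_ne_zero'.2 Real.pi_pos)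
  have hright := ((((hstirling.add_const (Real.log 2 / 2)).const_mul (1 - a)).sub
    (Real.tendsto_harmonic_sub_log.const_mul ((1 - a) / 2))).add_const
    ((a + 1) / 2 * Real.log a)).add
    ((tendsto_partialError ha).sub ((tendsto_partialError ha').const_mul a))
  have heq := tendsto_nhds_unique_of_eventuallyEq hleft hright (by
    filter_upwards [eventually_gt_atTop 0] with N hN
    rw [← partialMain_sub ha hN, sum_digammaRemainder ha, sum_digammaRemainder ha',
      doubleSum_eq_mul_inv ha]
    ring)
  rw [Real.log_sqrt Real.pi_pos.le] at heq
  rw [Real.log_mul two_ne_zero Real.pi_ne_zero]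
  linarith

theorem phi_even (t : ℝ) : phi t = phi (-t) := by
  have hS := S_functional_equation (Real.exp_pos (-2 * t))
  rw [← Real.exp_neg, Real.log_exp] at hS
  have hexp : Real.exp (-2 * t) = Real.exp (-t) * Real.exp (-t) := by
    rw [← Real.exp_add]
    ring_nf
  have hmul : Real.exp t * Real.exp (-t) = 1 := by
    rw [← Real.exp_add, add_neg_cancel, Real.exp_zero]
  have hneg : -2 * -t = -(-2 * t) := by ring
  have hsinh : (if t = 0 then (3 / 2 : ℝ) else 3 * t / (2 * Real.sinh t)) =
      if -t = 0 then 3 / 2 else 3 * -t / (2 * Real.sinh (-t)) := by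
    simp only [neg_eq_zero, Real.sinh_neg, mul_neg, neg_div_neg_eq]
  rw [phi, phi, ← hsinh, hneg, neg_neg, hS, hexp]
  linear_combination (Real.exp (-t) * S (Real.exp (-(-2 * t))) - Real.exp (-t) *
    ((Real.log (2 * π) - Real.eulerMascheroniConstant) / 2) - t * Real.exp (-t)) * hmul
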